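/- Let d_y, d_z, N be positive natural numbers and M < N. For each i ∈ {1,…,N} let lik_i : ℝ^{d_y} × ℝ^{d_z} × ℝ^{d_z} → [0,∞) and pL_i : ℝ^{d_z} → [0,∞) be measurable with ∫ lik_i(y, z_G, z) dy = 1 for all z_G, z ∈ ℝ^{d_z} and ∫ pL_i(z) dz = 1, and let pG : ℝ^{d_z} → [0,∞) be measurable. Define P_N(y_1,…,y_N) = ∫∫ (∏_{i=1}^N lik_i(y_i, z_G, z_i) pL_i(z_i)) pG(z_G) dz_1…dz_N dz_G and P_M(y_1,…,y_M) = ∫∫ (∏_{i=1}^M lik_i(y_i, z_G, z_i) pL_i(z_i)) pG(z_G) dz_1…dz_M dz_G. Then for all (y_1,…,y_M), ∫ P_N(y_1,…,y_N) dy_{M+1}…dy_N = P_M(y_1,…,y_M). -/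

import Mathlib

open MeasureTheory ENNReal

/-- Tonelli's theorem for a product of functions of separate variables. -/
theorem lintegral_fin_prod_eq_prod_lintegral {α : Type*} [MeasureSpace α]
    [SigmaFinite (volume : Measure α)] {n : ℕ} (f : Fin n → α → ℝ≥0∞)
    (hf : ∀ i, Measurable (f i)) :
    ∫⁻ x : Fin n → α, ∏ i, f i (x i) = ∏ i, ∫⁻ x, f i x := by
  induction n with
  | zero => simp [volume_pi]
  | succ n ih =>
    rw [← ((volume_preserving_piFinSuccAbove (fun _ : Fin (n + 1) => α) 0).symm).lintegral_comp_emb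
      (MeasurableEquiv.measurableEmbedding _)]
    simp only [Fin.prod_univ_succ, MeasurableEquiv.piFinSuccAbove_symm_apply,
      Fin.insertNthEquiv, Equiv.coe_fn_mk, Fin.insertNth_zero, Fin.cons_zero, Fin.cons_succ]
    rw [← ih (fun i => f i.succ) fun i => hf _]
    exact lintegral_prod_mul (hf 0).aemeasurable
      (Finset.measurable_prod _ fun i _ => (hf _).comp (measurable_pi_apply i)).aemeasurable

theorem Fin.prod_univ_eq_prod_castLE_mul {α : Type*} [CommMonoid α] {M N : ℕ} (h : M ≤ N)
    (f : Fin N → α) :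
    ∏ i, f i = (∏ i, f (Fin.castLE h i)) *
      ∏ j : Fin (N - M), f ⟨M + j, by have := j.isLt; omega⟩ := by
  obtain ⟨K, rfl⟩ := Nat.exists_eq_add_of_le h
  rw [Fin.prod_univ_add]
  congr 1
  exact (Fintype.prod_equiv (finCongr (Nat.add_sub_cancel_left (n := M) (m := K))) _ _
    fun _ => rfl).symm

/-- Marginal consistency of the DNP generative model: integrating the joint density over the
last `N - M` outputs recovers the joint density of the first `M` outputs. -/
theorem dnp_marginal_consistency (dy dz N M : ℕ) (hdy : 0 < dy) (hdz : 0 < dz) (hMN : M < N)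
    (lik : Fin N → EuclideanSpace ℝ (Fin dy) → EuclideanSpace ℝ (Fin dz) →
      EuclideanSpace ℝ (Fin dz) → ℝ≥0∞)
    (pL : Fin N → EuclideanSpace ℝ (Fin dz) → ℝ≥0∞)
    (pG : EuclideanSpace ℝ (Fin dz) → ℝ≥0∞)
    (hlik : ∀ i, Measurable (fun p : EuclideanSpace ℝ (Fin dy) × EuclideanSpace ℝ (Fin dz) ×
      EuclideanSpace ℝ (Fin dz) => lik i p.1 p.2.1 p.2.2))
    (hpL : ∀ i, Measurable (pL i)) (hpG : Measurable pG)
    (hlik1 : ∀ i zG z, (∫⁻ y, lik i y zG z) = 1)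
    (hpL1 : ∀ i, (∫⁻ z, pL i z) = 1)
    (yM : Fin M → EuclideanSpace ℝ (Fin dy)) :
    (∫⁻ yR : Fin (N - M) → EuclideanSpace ℝ (Fin dy),
      ∫⁻ zG, ∫⁻ z : Fin N → EuclideanSpace ℝ (Fin dz),
        (∏ i, lik i
            (if h : (i : ℕ) < M then yM ⟨i, h⟩
              else yR ⟨(i : ℕ) - M, by have := i.isLt; omega⟩) zG (z i) * pL i (z i)) * pG zG) =
    ∫⁻ zG, ∫⁻ z : Fin M → EuclideanSpace ℝ (Fin dz),
        (∏ i, lik (Fin.castLE hMN.le i) (yM i) zG (z i) *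
          pL (Fin.castLE hMN.le i) (z i)) * pG zG := by
  let g : Fin N → EuclideanSpace ℝ (Fin dz) → EuclideanSpace ℝ (Fin dy) → ℝ≥0∞ :=
    fun i zG y => ∫⁻ z, lik i y zG z * pL i z
  have hmeas : ∀ i, Measurable fun p : (EuclideanSpace ℝ (Fin dz) × EuclideanSpace ℝ (Fin dy)) ×
      EuclideanSpace ℝ (Fin dz) => lik i p.1.2 p.1.1 p.2 * pL i p.2 := fun i =>
    ((hlik i).comp (by fun_prop : Measurable
      fun p : (EuclideanSpace ℝ (Fin dz) × EuclideanSpace ℝ (Fin dy)) ×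
        EuclideanSpace ℝ (Fin dz) => (p.1.2, p.1.1, p.2))).mul
      ((hpL i).comp measurable_snd)
  have hg : ∀ i, Measurable fun p : EuclideanSpace ℝ (Fin dz) × EuclideanSpace ℝ (Fin dy) =>
      g i p.1 p.2 := fun i => (hmeas i).lintegral_prod_right'
  have hz : ∀ i y zG, Measurable fun z => lik i y zG z * pL i z := fun i y zG =>
    (hmeas i).comp (measurable_prodMk_left (x := (zG, y)))
  have hg1 : ∀ i zG, ∫⁻ y, g i zG y = 1 := by
    intro i zG
    have hm : Measurable fun p : EuclideanSpace ℝ (Fin dy) × EuclideanSpace ℝ (Fin dz) =>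
        lik i p.1 zG p.2 * pL i p.2 :=
      (hmeas i).comp (by fun_prop : Measurable
        fun p : EuclideanSpace ℝ (Fin dy) × EuclideanSpace ℝ (Fin dz) => ((zG, p.1), p.2))
    have hy : ∀ z, Measurable fun y => lik i y zG z := fun z =>
      (hlik i).comp (by fun_prop : Measurable
        fun y : EuclideanSpace ℝ (Fin dy) => (y, zG, z))
    simp only [g]
    rw [lintegral_lintegral_swap hm.aemeasurable]
    rw [← hpL1 i]
    refine lintegral_congr fun z => ?_
    rw [lintegral_mul_const _ (hy z), hlik1, one_mul]
  have hlocal : ∀ {n : ℕ} (e : Fin n → Fin N) (y : Fin n → EuclideanSpace ℝ (Fin dy))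
      (zG : EuclideanSpace ℝ (Fin dz)),
      ∫⁻ z : Fin n → EuclideanSpace ℝ (Fin dz),
        (∏ i, lik (e i) (y i) zG (z i) * pL (e i) (z i)) * pG zG =
      (∏ i, g (e i) zG (y i)) * pG zG := by
    intro n e y zG
    have hm : Measurable fun z : Fin n → EuclideanSpace ℝ (Fin dz) =>
        ∏ i, lik (e i) (y i) zG (z i) * pL (e i) (z i) :=
      Finset.measurable_fun_prod _ fun i _ => (hz (e i) (y i) zG).comp (measurable_pi_apply i)
    rw [lintegral_mul_const _ hm,
      lintegral_fin_prod_eq_prod_lintegral (fun i z => lik (e i) (y i) zG z * pL (e i) z)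
        fun i => hz _ _ _]
  rw [lintegral_congr (hlocal (Fin.castLE hMN.le) yM)]
  refine (lintegral_congr fun yR : Fin (N - M) → EuclideanSpace ℝ (Fin dy) =>
    lintegral_congr (hlocal id fun i =>
    if h : (i : ℕ) < M then yM ⟨i, h⟩
      else yR ⟨(i : ℕ) - M, by have := i.isLt; omega⟩)).trans ?_
  simp only [id, Fin.prod_univ_eq_prod_castLE_mul hMN.le]
  simp only [Fin.val_castLE, Fin.is_lt, dite_true, Fin.eta, add_lt_iff_neg_left, Nat.not_lt_zero,
    dite_false, add_tsub_cancel_left]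
  have hgR : ∀ j : Fin (N - M), Measurable
      fun p : (Fin (N - M) → EuclideanSpace ℝ (Fin dy)) × EuclideanSpace ℝ (Fin dz) =>
        g ⟨M + j, by have := j.isLt; omega⟩ p.2 (p.1 j) := fun j =>
    (hg ⟨M + j, by have := j.isLt; omega⟩).comp (by fun_prop : Measurable
      fun p : (Fin (N - M) → EuclideanSpace ℝ (Fin dy)) × EuclideanSpace ℝ (Fin dz) =>
        (p.2, p.1 j))
  have hgM : ∀ i : Fin M, Measurable fun zG => g (Fin.castLE hMN.le i) zG (yM i) := fun i =>
    (hg (Fin.castLE hMN.le i)).comp measurable_prodMk_right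
  rw [lintegral_lintegral_swap]
  · refine lintegral_congr fun zG => ?_
    have hgzG : ∀ j : Fin (N - M), Measurable (g ⟨M + j, by have := j.isLt; omega⟩ zG) :=
      fun j => (hg _).comp measurable_prodMk_left
    have hprod : Measurable fun yR : Fin (N - M) → EuclideanSpace ℝ (Fin dy) =>
        ∏ j : Fin (N - M), g ⟨M + j, by have := j.isLt; omega⟩ zG (yR j) :=
      Finset.measurable_fun_prod _ fun j _ => (hgzG j).comp (measurable_pi_apply j)
    rw [lintegral_mul_const _ (hprod.const_mul _), lintegral_const_mul _ hprod,
      lintegral_fin_prod_eq_prod_lintegral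
        (fun j : Fin (N - M) => g ⟨M + j, by have := j.isLt; omega⟩ zG) hgzG]
    simp [hg1]
  · exact (((Finset.measurable_fun_prod _ fun i _ => (hgM i).comp measurable_snd).mul
      (Finset.measurable_fun_prod _ fun j _ => hgR j)).mul (hpG.comp measurable_snd)).aemeasurable
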